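/- arXiv:2207.00180 — 4 statements merged into one kernel-verified Lean document; each statement's English description precedes it below -/
import Mathlib

section
/- Let 0 = s_0 < s_1 < ... < s_{M1} = T and 0 = t_0 < t_1 < ... < t_{M2} = T be two finite partitions of the interval [0,T], and set I_i = (s_{i-1}, s_i] and J_j = (t_{j-1}, t_j]. Define the M1 × M2 real matrix G by G_{ij} = |I_i ∩ J_j| / (|I_i|^{1/2} |J_j|^{1/2}), where |K| denotes the length of an interval K. Then the operator norm of G (and of its transpose) is at most 1. -/
open Matrix

/-- The operator norm of a real matrix with respect to Euclidean norms. -/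
noncomputable def matOpNorm {m n : Type*} [Fintype m] [Fintype n] [DecidableEq n]
    (A : Matrix m n ℝ) : ℝ :=
  ‖LinearMap.toContinuousLinearMap (Matrix.toEuclideanLin A)‖

lemma overlap_row_sum {n : ℕ} (t : Fin (n + 1) → ℝ) (ht : StrictMono t) (a b : ℝ) (hab : a < b) :
    ∑ j : Fin n, max 0 (min b (t j.succ) - max a (t j.castSucc)) ≤ b - a := by
  have key : ∀ j : Fin n, max 0 (min b (t j.succ) - max a (t j.castSucc)) =
      max a (min b (t j.succ)) - max a (min b (t j.castSucc)) := by
    intro j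
    have h : t j.castSucc < t j.succ := ht j.castSucc_lt_succ
    generalize t j.castSucc = c at *
    generalize t j.succ = d at *
    grind
  simp_rw [key]
  have h1 := Fin.sum_univ_succ (fun k : Fin (n + 1) => max a (min b (t k)))
  have h2 := Fin.sum_univ_castSucc (fun k : Fin (n + 1) => max a (min b (t k)))
  rw [Finset.sum_sub_distrib]
  have h3 : max a (min b (t (Fin.last n))) ≤ b := by simp [hab.le]
  have h4 : a ≤ max a (min b (t 0)) := le_max_left _ _
  linarith

lemma matOpNorm_le_one_of_weights {m n : ℕ} (w : Fin m → Fin n → ℝ) (a : Fin m → ℝ)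
    (b : Fin n → ℝ) (hw : ∀ i j, 0 ≤ w i j) (ha : ∀ i, 0 < a i) (hb : ∀ j, 0 < b j)
    (hr : ∀ i, ∑ j, w i j ≤ a i) (hc : ∀ j, ∑ i, w i j ≤ b j)
    (G : Matrix (Fin m) (Fin n) ℝ)
    (hG : ∀ i j, G i j = w i j / (Real.sqrt (a i) * Real.sqrt (b j))) :
    matOpNorm G ≤ 1 := by
  unfold matOpNorm
  refine ContinuousLinearMap.opNorm_le_bound _ zero_le_one fun x => ?_
  rw [one_mul, EuclideanSpace.norm_eq, EuclideanSpace.norm_eq]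
  apply Real.sqrt_le_sqrt
  simp only [LinearMap.coe_toContinuousLinearMap', Real.norm_eq_abs, sq_abs]
  have row : ∀ i, (Matrix.toEuclideanLin G x) i ^ 2 ≤ ∑ j, w i j * (x j ^ 2 / b j) := by
    intro i
    have e : (Matrix.toEuclideanLin G x) i = ∑ j, G i j * x j := by
      simp [Matrix.toLpLin_apply, Matrix.mulVec, dotProduct]
    rw [e]
    have cs := Finset.sum_sq_le_sum_mul_sum_of_sq_eq_mul Finset.univ
      (r := fun j => G i j * x j) (f := fun j => w i j / a i)
      (g := fun j => w i j * (x j ^ 2 / b j))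
      (fun j _ => div_nonneg (hw i j) (ha i).le)
      (fun j _ => mul_nonneg (hw i j) (div_nonneg (sq_nonneg _) (hb j).le))
      (fun j _ => by
        have := (ha i).ne'
        have := (hb j).ne'
        simp only [hG, mul_pow, div_pow, Real.sq_sqrt (ha i).le, Real.sq_sqrt (hb j).le]
        field_simp)
    refine cs.trans (mul_le_of_le_one_left ?_ ?_)
    · exact Finset.sum_nonneg fun j _ =>
        mul_nonneg (hw i j) (div_nonneg (sq_nonneg _) (hb j).le)
    · rw [← Finset.sum_div]
      exact (div_le_one (ha i)).2 (hr i)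
  refine (Finset.sum_le_sum fun i _ => row i).trans ?_
  rw [Finset.sum_comm]
  refine Finset.sum_le_sum fun j _ => ?_
  rw [← Finset.sum_mul]
  calc _ ≤ b j * (x j ^ 2 / b j) :=
        mul_le_mul_of_nonneg_right (hc j) (div_nonneg (sq_nonneg _) (hb j).le)
    _ = x j ^ 2 := mul_div_cancel₀ _ (ne_of_gt (hb j))

/-- For two partitions `0 = s₀ < … < s_{M₁} = T` and
`0 = t₀ < … < t_{M₂} = T` of `[0,T]`, the matrix
`G_{ij} = |I_i ∩ J_j| / (|I_i|^{1/2} |J_j|^{1/2})` (where `I_i = (s_{i-1}, s_i]`,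
`J_j = (t_{j-1}, t_j]`) and its transpose have operator norm at most 1. -/
theorem opNorm_overlap_matrix_le_one
    {M1 M2 : ℕ} {T : ℝ} (hT : 0 < T)
    (s : Fin (M1 + 1) → ℝ) (t : Fin (M2 + 1) → ℝ)
    (hs : StrictMono s) (ht : StrictMono t)
    (hs0 : s 0 = 0) (hsT : s (Fin.last M1) = T)
    (ht0 : t 0 = 0) (htT : t (Fin.last M2) = T)
    (G : Matrix (Fin M1) (Fin M2) ℝ)
    (hG : ∀ i j, G i j =
      (max 0 (min (s i.succ) (t j.succ) - max (s i.castSucc) (t j.castSucc))) /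
        (Real.sqrt (s i.succ - s i.castSucc) * Real.sqrt (t j.succ - t j.castSucc))) :
    matOpNorm G ≤ 1 ∧ matOpNorm Gᵀ ≤ 1 := by
  have ha : ∀ i : Fin M1, 0 < s i.succ - s i.castSucc := fun i =>
    sub_pos.2 (hs i.castSucc_lt_succ)
  have hb : ∀ j : Fin M2, 0 < t j.succ - t j.castSucc := fun j =>
    sub_pos.2 (ht j.castSucc_lt_succ)
  have hr : ∀ i : Fin M1, ∑ j : Fin M2,
      max 0 (min (s i.succ) (t j.succ) - max (s i.castSucc) (t j.castSucc)) ≤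
        s i.succ - s i.castSucc := fun i =>
    overlap_row_sum t ht _ _ (hs i.castSucc_lt_succ)
  have hc : ∀ j : Fin M2, ∑ i : Fin M1,
      max 0 (min (s i.succ) (t j.succ) - max (s i.castSucc) (t j.castSucc)) ≤
        t j.succ - t j.castSucc := fun j => by
    have h := overlap_row_sum s hs _ _ (ht j.castSucc_lt_succ)
    simpa only [min_comm (t j.succ), max_comm (t j.castSucc)] using h
  constructor
  · exact matOpNorm_le_one_of_weights _ _ _ (fun i j => le_max_left _ _) ha hb hr hc G hG
  · exact matOpNorm_le_one_of_weights
      (fun j i => max 0 (min (s i.succ) (t j.succ) - max (s i.castSucc) (t j.castSucc)))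
      _ _ (fun i j => le_max_left _ _) hb ha hc hr Gᵀ
      (fun j i => by rw [Matrix.transpose_apply, hG, mul_comm (Real.sqrt _)])
end

section
/- Let λ ∈ [0,1] and ρ, ρ₀ ∈ [−1,1] be real numbers with λρ² < 1. Then (λρρ₀ − 1)/(1 − λρ²) ≤ −(λ/3)(ρ − ρ₀)². -/
/-- For `λ ∈ [0,1]`, `ρ, ρ₀ ∈ [−1,1]` with `λρ² < 1`:
`(λρρ₀ − 1)/(1 − λρ²) ≤ −(λ/3)(ρ − ρ₀)²`. -/
theorem correlation_ratio_bound (l ρ ρ₀ : ℝ)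
    (hl0 : 0 ≤ l) (hl1 : l ≤ 1)
    (hρ : |ρ| ≤ 1) (hρ₀ : |ρ₀| ≤ 1) (h : l * ρ ^ 2 < 1) :
    (l * ρ * ρ₀ - 1) / (1 - l * ρ ^ 2) ≤ -(l / 3) * (ρ - ρ₀) ^ 2 := by
  have hpos : 0 < 1 - l * ρ ^ 2 := by linarith
  rw [div_le_iff₀ hpos]
  have h1 : ρ ^ 2 ≤ 1 := (sq_le_one_iff_abs_le_one ρ).2 hρ
  have h2 : ρ₀ ^ 2 ≤ 1 := (sq_le_one_iff_abs_le_one ρ₀).2 hρ₀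
  have hq : 0 ≤ l * (ρ - ρ₀) ^ 2 := by positivity
  have h3 : l * (ρ - ρ₀) ^ 2 ≤ 2 - 2 * (l * ρ * ρ₀) := by
    have e1 := mul_le_mul_of_nonneg_left h1 hl0
    have e2 := mul_le_mul_of_nonneg_left h2 hl0
    linarith [show l * (ρ - ρ₀) ^ 2 = l * ρ ^ 2 + l * ρ₀ ^ 2 - 2 * (l * ρ * ρ₀) by ring]
  have h4 : l * (ρ - ρ₀) ^ 2 * (1 - l * ρ ^ 2) ≤ l * (ρ - ρ₀) ^ 2 := by
    apply mul_le_of_le_one_right hq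
    have : 0 ≤ l * ρ ^ 2 := by positivity
    linarith
  linarith [show -(l / 3) * (ρ - ρ₀) ^ 2 * (1 - l * ρ ^ 2)
    = -(l * (ρ - ρ₀) ^ 2 * (1 - l * ρ ^ 2)) / 3 by ring]
end

section
/- Let 0 ≤ λ ≤ 1, let ρ̄ ∈ [0,1), let ρ and ρ₀ be real numbers with |ρ| ≤ ρ̄ and |ρ₀| ≤ ρ̄, and let B be any real number. Set g = √(1 − λρ²) and g₀ = √(1 − λρ₀²) (both are strictly positive). Then (B·g₀/g − 1)² ≥ ((1 − ρ̄²)/2)·(B − 1)² − (λ/(1 − ρ̄²))·(ρ − ρ₀)². -/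
/-- For `0 ≤ λ ≤ 1`, `0 ≤ ρ̄ < 1`, `|ρ| ≤ ρ̄`, `|ρ₀| ≤ ρ̄`, any real `B`,
with `g = √(1 − λρ²)` and `g₀ = √(1 − λρ₀²)`:
`(B g₀/g − 1)² ≥ ((1 − ρ̄²)/2)(B − 1)² − (λ/(1 − ρ̄²))(ρ − ρ₀)²`. -/
theorem scaled_ratio_lower_bound (l ρbar ρ ρ₀ B : ℝ)
    (hl0 : 0 ≤ l) (hl1 : l ≤ 1) (hρbar0 : 0 ≤ ρbar) (hρbar1 : ρbar < 1)
    (hρ : |ρ| ≤ ρbar) (hρ₀ : |ρ₀| ≤ ρbar) :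
    (B * Real.sqrt (1 - l * ρ₀ ^ 2) / Real.sqrt (1 - l * ρ ^ 2) - 1) ^ 2 ≥
      (1 - ρbar ^ 2) / 2 * (B - 1) ^ 2 - l / (1 - ρbar ^ 2) * (ρ - ρ₀) ^ 2 := by
  have hc : 0 < 1 - ρbar ^ 2 := by nlinarith
  have h1 : ρ ^ 2 ≤ ρbar ^ 2 := sq_le_sq' (abs_le.1 hρ).1 (abs_le.1 hρ).2
  have h2 : ρ₀ ^ 2 ≤ ρbar ^ 2 := sq_le_sq' (abs_le.1 hρ₀).1 (abs_le.1 hρ₀).2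
  have k1 : l * ρ ^ 2 ≤ ρ ^ 2 := mul_le_of_le_one_left (sq_nonneg _) hl1
  have k2 : l * ρ₀ ^ 2 ≤ ρ₀ ^ 2 := mul_le_of_le_one_left (sq_nonneg _) hl1
  have n1 : 0 ≤ l * ρ ^ 2 := by positivity
  have n2 : 0 ≤ l * ρ₀ ^ 2 := by positivity
  have hg0 : 0 < Real.sqrt (1 - l * ρ ^ 2) := Real.sqrt_pos.2 (by linarith)
  have hh0 : 0 < Real.sqrt (1 - l * ρ₀ ^ 2) := Real.sqrt_pos.2 (by linarith)
  have hg : Real.sqrt (1 - l * ρ ^ 2) ^ 2 = 1 - l * ρ ^ 2 := Real.sq_sqrt (by linarith)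
  have hh : Real.sqrt (1 - l * ρ₀ ^ 2) ^ 2 = 1 - l * ρ₀ ^ 2 := Real.sq_sqrt (by linarith)
  generalize Real.sqrt (1 - l * ρ ^ 2) = g at *
  generalize Real.sqrt (1 - l * ρ₀ ^ 2) = h at *
  obtain ⟨c, hcd⟩ : ∃ c, c = 1 - ρbar ^ 2 := ⟨_, rfl⟩
  rw [← hcd] at hc ⊢
  have gc : c ≤ g ^ 2 := by linarith
  have hc' : c ≤ h ^ 2 := by linarith
  have g1 : g ^ 2 ≤ 1 := by linarith
  have A1 : c ≤ 2 * h ^ 2 - c * g ^ 2 := by nlinarith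
  have A2 : 4 * c ≤ (g + h) ^ 2 := by
    have : c ≤ g * h := by
      refine (pow_le_pow_iff_left₀ hc.le (by positivity) two_ne_zero).1 ?_
      calc c ^ 2 = c * c := by ring
        _ ≤ g ^ 2 * h ^ 2 := by gcongr
        _ = (g * h) ^ 2 := by ring
    nlinarith
  have A3 : l * (ρ + ρ₀) ^ 2 ≤ 4 := by nlinarith [sq_nonneg (ρ - ρ₀), mul_nonneg hl0 (sq_nonneg (ρ - ρ₀))]
  have A4 : c ^ 2 * (l * (ρ + ρ₀) ^ 2) ≤ (2 * h ^ 2 - c * g ^ 2) * (g + h) ^ 2 := by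
    calc _ ≤ c ^ 2 * 4 := by gcongr
      _ = c * (4 * c) := by ring
      _ ≤ _ := by gcongr; linarith
  have A5 : c ^ 2 * (h - g) ^ 2 ≤ l * (ρ - ρ₀) ^ 2 * (2 * h ^ 2 - c * g ^ 2) := by
    have e : (h - g) * (g + h) = l * (ρ - ρ₀) * (ρ + ρ₀) := by linear_combination hh - hg
    have p : 0 < (g + h) ^ 2 := by positivity
    refine le_of_mul_le_mul_right ?_ p
    calc c ^ 2 * (h - g) ^ 2 * (g + h) ^ 2 = c ^ 2 * ((h - g) * (g + h)) ^ 2 := by ring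
      _ = l * (ρ - ρ₀) ^ 2 * (c ^ 2 * (l * (ρ + ρ₀) ^ 2)) := by rw [e]; ring
      _ ≤ l * (ρ - ρ₀) ^ 2 * ((2 * h ^ 2 - c * g ^ 2) * (g + h) ^ 2) := by gcongr
      _ = _ := by ring
  have P : 0 < 2 * h ^ 2 - c * g ^ 2 := by linarith
  have key : 0 ≤ 2 * c * (B * h - g) ^ 2 - c ^ 2 * g ^ 2 * (B - 1) ^ 2
      + 2 * g ^ 2 * (l * (ρ - ρ₀) ^ 2) := by
    refine nonneg_of_mul_nonneg_right (a := 2 * h ^ 2 - c * g ^ 2) ?_ P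
    have s : 0 ≤ c * ((2 * h ^ 2 - c * g ^ 2) * (B - 1) + 2 * h * (h - g)) ^ 2 := by positivity
    have t := mul_le_mul_of_nonneg_left A5 (sq_nonneg g)
    linear_combination s + 2 * t
  have e : (B * h / g - 1) ^ 2 - (c / 2 * (B - 1) ^ 2 - l / c * (ρ - ρ₀) ^ 2)
      = (2 * c * (B * h - g) ^ 2 - c ^ 2 * g ^ 2 * (B - 1) ^ 2
      + 2 * g ^ 2 * (l * (ρ - ρ₀) ^ 2)) / (2 * c * g ^ 2) := by
    field_simp
    ring
  have : 0 ≤ (B * h / g - 1) ^ 2 - (c / 2 * (B - 1) ^ 2 - l / c * (ρ - ρ₀) ^ 2) := by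
    rw [e]; positivity
  linarith
end

section
/- Let 0 = s_0 < ... < s_{M1} = T and 0 = t_0 < ... < t_{M2} = T be two finite partitions of [0,T]; write I_i = (s_{i-1}, s_i] for 1 ≤ i ≤ M1 and I_{M1+j} = (t_{j-1}, t_j] for 1 ≤ j ≤ M2, and set M = M1 + M2, with ψ(i) = 1 for i ≤ M1 and ψ(i) = 2 for i > M1. Let f : [0,T] → ℝ^{2×2} be a measurable matrix-valued function such that for all t, every entry satisfies |[f(t)]_{kl}| ≤ c₂ for a constant c₂ > 0. Let J ⊆ [0,T] be an interval, and define the M × M matrix S^{(J)} by [S^{(J)}]_{ij} = ∫_{I_i ∩ I_j ∩ J} [f(t)]_{ψ(i)ψ(j)} dt, and let D be the diagonal matrix with entries |I_i|. Then (i) ‖D^{-1/2} S^{(J)} D^{-1/2}‖ ≤ 2 c₂, and (ii) tr(D^{-1/2} |S^{(J)}| D^{-1/2}) ≤ c₂ · #{i : 1 ≤ i ≤ M, I_i ∩ J ≠ ∅}, where |S^{(J)}| on the diagonal means the diagonal entries are bounded: Σ_{i=1}^M |I_i|^{-1} ∫_{I_i ∩ J} |[f(t)]_{ψ(i)ψ(i)}|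 dt ≤ c₂ · #{i : I_i ∩ J ≠ ∅}. -/
open Matrix MeasureTheory

theorem schur_aux {n : Type*} [Fintype n] [DecidableEq n] (A B : Matrix n n ℝ) (w : n → ℝ) (K : ℝ)
    (hK : 0 ≤ K) (hw : ∀ i, 0 < w i) (hAB : ∀ i j, |A i j| ≤ B i j)
    (hsymm : ∀ i j, B i j = B j i) (hsum : ∀ i, ∑ j, B i j * w j ≤ K * w i) :
    matOpNorm A ≤ K := by
  have hB : ∀ i j, 0 ≤ B i j := fun i j => (abs_nonneg _).trans (hAB i j)
  unfold matOpNorm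
  refine ContinuousLinearMap.opNorm_le_bound _ hK fun x => ?_
  rw [LinearMap.coe_toContinuousLinearMap']
  refine le_of_sq_le_sq ?_ (by positivity)
  rw [mul_pow, EuclideanSpace.real_norm_sq_eq, EuclideanSpace.real_norm_sq_eq]
  have hrow : ∀ i, (Matrix.toEuclideanLin A x i) ^ 2 ≤
      ∑ j, K * w i * (B i j * (x j ^ 2 / w j)) := by
    intro i
    have e : Matrix.toEuclideanLin A x i = ∑ j, A i j * x j := by
      simp [Matrix.toLpLin_apply, Matrix.mulVec, dotProduct]
    have h1 : |∑ j, A i j * x j| ≤ ∑ j, B i j * |x j| := by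
      refine (Finset.abs_sum_le_sum_abs _ _).trans (Finset.sum_le_sum fun j _ => ?_)
      rw [abs_mul]
      exact mul_le_mul_of_nonneg_right (hAB i j) (abs_nonneg _)
    have h2 : (∑ j, B i j * |x j|) ^ 2 ≤ (∑ j, B i j * w j) * ∑ j, B i j * (x j ^ 2 / w j) := by
      apply Finset.sum_sq_le_sum_mul_sum_of_sq_eq_mul
      · intro j _; exact mul_nonneg (hB i j) (hw j).le
      · intro j _
        have := hw j
        have := hB i j
        positivity
      · intro j _
        have := (hw j).ne'
        rw [mul_pow, sq_abs]
        field_simp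
    rw [e, ← Finset.mul_sum]
    calc (∑ j, A i j * x j) ^ 2 = |∑ j, A i j * x j| ^ 2 := (sq_abs _).symm
      _ ≤ (∑ j, B i j * |x j|) ^ 2 := by gcongr
      _ ≤ _ := h2
      _ ≤ _ := by
        refine mul_le_mul_of_nonneg_right (hsum i) (Finset.sum_nonneg fun j _ => ?_)
        have := hw j
        have := hB i j
        positivity
  refine (Finset.sum_le_sum fun i _ => hrow i).trans ?_
  rw [Finset.sum_comm, Finset.mul_sum]
  refine Finset.sum_le_sum fun j _ => ?_
  have hwj := hw j
  calc ∑ i, K * w i * (B i j * (x j ^ 2 / w j))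
      = K * (x j ^ 2 / w j) * ∑ i, B j i * w i := by
        rw [Finset.mul_sum]
        refine Finset.sum_congr rfl fun i _ => ?_
        rw [hsymm i j]; ring
    _ ≤ K * (x j ^ 2 / w j) * (K * w j) :=
        mul_le_mul_of_nonneg_left (hsum j) (by positivity)
    _ = K ^ 2 * x j ^ 2 := by field_simp

theorem partition_aux {m : ℕ} (s : Fin (m + 1) → ℝ) (hs : StrictMono s) (c d : ℝ) (hcd : c ≤ d) :
    ∑ j : Fin m, volume.real (Set.Ioc c d ∩ Set.Ioc (s j.castSucc) (s j.succ)) ≤ d - c := by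
  have key : ∀ i j : Fin m, i < j →
      Disjoint (Set.Ioc (s i.castSucc) (s i.succ)) (Set.Ioc (s j.castSucc) (s j.succ)) := by
    intro i j hij
    rw [Set.disjoint_left]
    intro x hx hy
    have : s i.succ ≤ s j.castSucc := hs.monotone (by
      rw [Fin.le_def]; simp; omega)
    exact absurd (hx.2.trans this) (not_le.2 hy.1)
  rw [← measureReal_biUnion_finset (h := fun j _ =>
    (lt_of_le_of_lt (measure_mono Set.inter_subset_left) (by simp)).ne)]
  · calc _ ≤ volume.real (Set.Ioc c d) := by
          refine measureReal_mono (Set.iUnion₂_subset fun j _ => Set.inter_subset_left) ?_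
          simp
      _ = d - c := by rw [Real.volume_real_Ioc_of_le hcd]
  · intro i _ j _ hij
    refine Disjoint.mono Set.inter_subset_right Set.inter_subset_right ?_
    rcases lt_or_gt_of_ne hij with h | h
    · exact key i j h
    · exact (key j i h).symm
  · intro j _
    exact measurableSet_Ioc.inter measurableSet_Ioc

/-- Given two partitions of `[0,T]` (combined into the family of
intervals `I_i`, indexed by `Fin M1 ⊕ Fin M2`, with group label `ψ`), a measurable
`2 × 2` matrix-valued function `f` on `[0,T]` whose entries are bounded by `c₂`, and an
interval `J = (a,b] ⊆ [0,T]`, the matrix `[S^{(J)}]_{ij} = ∫_{I_i ∩ I_j ∩ J} [f(t)]_{ψ(i)ψ(j)} dt`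
satisfies (i) `‖D^{-1/2} S^{(J)} D^{-1/2}‖ ≤ 2c₂` where `D = diag(|I_i|)`, and
(ii) `Σ_i |I_i|⁻¹ ∫_{I_i ∩ J} |[f(t)]_{ψ(i)ψ(i)}| dt ≤ c₂ · #{i : I_i ∩ J ≠ ∅}`. -/
theorem localized_covariance_matrix_bounds
    {M1 M2 : ℕ} {T : ℝ} (hT : 0 < T)
    (s : Fin (M1 + 1) → ℝ) (t : Fin (M2 + 1) → ℝ)
    (hs : StrictMono s) (ht : StrictMono t)
    (hs0 : s 0 = 0) (hsT : s (Fin.last M1) = T)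
    (ht0 : t 0 = 0) (htT : t (Fin.last M2) = T)
    (lo hi : Fin M1 ⊕ Fin M2 → ℝ)
    (hlo : lo = Sum.elim (fun i => s i.castSucc) (fun j => t j.castSucc))
    (hhi : hi = Sum.elim (fun i => s i.succ) (fun j => t j.succ))
    (ψ : Fin M1 ⊕ Fin M2 → Fin 2)
    (hψ : ψ = Sum.elim (fun _ => 0) (fun _ => 1))
    (Iv : Fin M1 ⊕ Fin M2 → Set ℝ) (hIv : ∀ i, Iv i = Set.Ioc (lo i) (hi i))
    (f : ℝ → Matrix (Fin 2) (Fin 2) ℝ) (c₂ : ℝ) (hc₂ : 0 < c₂)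
    (hf_meas : ∀ k l, Measurable fun u => f u k l)
    (hf_bdd : ∀ u ∈ Set.Icc (0 : ℝ) T, ∀ k l, |f u k l| ≤ c₂)
    (a b : ℝ) (hJ : Set.Ioc a b ⊆ Set.Icc (0 : ℝ) T)
    (S : Matrix (Fin M1 ⊕ Fin M2) (Fin M1 ⊕ Fin M2) ℝ)
    (hS : ∀ i j, S i j = ∫ u in (Iv i ∩ Iv j ∩ Set.Ioc a b), f u (ψ i) (ψ j)) :
    matOpNorm (Matrix.diagonal (fun i => (Real.sqrt (hi i - lo i))⁻¹) * S *
        Matrix.diagonal (fun i => (Real.sqrt (hi i - lo i))⁻¹)) ≤ 2 * c₂ ∧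
      ∑ i : Fin M1 ⊕ Fin M2, (hi i - lo i)⁻¹ * ∫ u in (Iv i ∩ Set.Ioc a b), |f u (ψ i) (ψ i)| ≤
        c₂ * ({i : Fin M1 ⊕ Fin M2 | (Iv i ∩ Set.Ioc a b).Nonempty}.ncard : ℝ) := by
  have hlt : ∀ i, lo i < hi i := by
    intro i
    subst hlo hhi
    rcases i with i | i
    · exact hs Fin.castSucc_lt_succ
    · exact ht Fin.castSucc_lt_succ
  have hIfin : ∀ i, volume (Iv i) < ⊤ := by
    intro i; rw [hIv]; simp
  have hIreal : ∀ i, volume.real (Iv i) = hi i - lo i := by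
    intro i; rw [hIv, Real.volume_real_Ioc_of_le (hlt i).le]
  constructor
  · refine schur_aux _ (Matrix.of fun i j => c₂ * volume.real (Iv i ∩ Iv j) *
      ((Real.sqrt (hi i - lo i))⁻¹ * (Real.sqrt (hi j - lo j))⁻¹))
      (fun i => Real.sqrt (hi i - lo i)) _ (by positivity) ?_ ?_ ?_ ?_
    · intro i; exact Real.sqrt_pos.2 (sub_pos.2 (hlt i))
    · intro i j
      rw [Matrix.mul_diagonal, Matrix.diagonal_mul, Matrix.of_apply]
      have hfin : volume (Iv i ∩ Iv j ∩ Set.Ioc a b) < ⊤ :=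
        lt_of_le_of_lt (measure_mono (Set.inter_subset_left.trans Set.inter_subset_left)) (hIfin i)
      have h1 : |S i j| ≤ c₂ * volume.real (Iv i ∩ Iv j) := by
        rw [hS, ← Real.norm_eq_abs]
        refine (norm_setIntegral_le_of_norm_le_const (C := c₂) hfin ?_).trans ?_
        · intro u hu
          exact hf_bdd u (hJ hu.2) _ _
        · refine mul_le_mul_of_nonneg_left (measureReal_mono Set.inter_subset_left ?_) hc₂.le
          exact (lt_of_le_of_lt (measure_mono Set.inter_subset_left) (hIfin i)).ne
      rw [abs_mul, abs_mul, abs_of_nonneg (inv_nonneg.2 (Real.sqrt_nonneg _)),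
        abs_of_nonneg (inv_nonneg.2 (Real.sqrt_nonneg _))]
      calc _ = |S i j| * ((Real.sqrt (hi i - lo i))⁻¹ * (Real.sqrt (hi j - lo j))⁻¹) := by ring
        _ ≤ _ := by gcongr
    · intro i j
      simp only [Matrix.of_apply]
      rw [Set.inter_comm]; ring
    · intro i
      have hd : ∀ j, Real.sqrt (hi j - lo j) ≠ 0 := fun j =>
        (Real.sqrt_pos.2 (sub_pos.2 (hlt j))).ne'
      have h2 : ∑ j, volume.real (Iv i ∩ Iv j) ≤ 2 * (hi i - lo i) := by
        rw [Fintype.sum_sum_type]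
        have e1 := partition_aux s hs (lo i) (hi i) (hlt i).le
        have e2 := partition_aux t ht (lo i) (hi i) (hlt i).le
        have e3 : ∀ j : Fin M1, Iv (Sum.inl j) = Set.Ioc (s j.castSucc) (s j.succ) := by
          intro j; rw [hIv, hlo, hhi]; rfl
        have e4 : ∀ j : Fin M2, Iv (Sum.inr j) = Set.Ioc (t j.castSucc) (t j.succ) := by
          intro j; rw [hIv, hlo, hhi]; rfl
        simp only [e3, e4, hIv i]
        linarith
      have h3 : Real.sqrt (hi i - lo i) * Real.sqrt (hi i - lo i) = hi i - lo i :=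
        Real.mul_self_sqrt (sub_pos.2 (hlt i)).le
      calc _ = c₂ * (Real.sqrt (hi i - lo i))⁻¹ * ∑ j, volume.real (Iv i ∩ Iv j) := by
            rw [Finset.mul_sum]
            refine Finset.sum_congr rfl fun j _ => ?_
            have := hd j
            simp only [Matrix.of_apply]
            field_simp
        _ ≤ c₂ * (Real.sqrt (hi i - lo i))⁻¹ * (2 * (hi i - lo i)) := by gcongr
        _ = c₂ * (Real.sqrt (hi i - lo i))⁻¹ *
              (2 * (Real.sqrt (hi i - lo i) * Real.sqrt (hi i - lo i))) := by rw [h3]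
        _ = _ := by
            have := hd i
            field_simp
  · classical
    rw [Set.ncard_eq_toFinset_card', Set.toFinset_ofPred, Finset.card_filter]
    push_cast
    rw [Finset.mul_sum]
    refine Finset.sum_le_sum fun i _ => ?_
    have hp : 0 < hi i - lo i := sub_pos.2 (hlt i)
    split_ifs with h
    · have hfin : volume (Iv i ∩ Set.Ioc a b) < ⊤ :=
        lt_of_le_of_lt (measure_mono Set.inter_subset_left) (hIfin i)
      have h1 : ∫ u in (Iv i ∩ Set.Ioc a b), |f u (ψ i) (ψ i)| ≤ c₂ * (hi i - lo i) := by
        refine (Real.le_norm_self _).trans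
          ((norm_setIntegral_le_of_norm_le_const (C := c₂) hfin ?_).trans ?_)
        · intro u hu
          rw [Real.norm_eq_abs, abs_abs]
          exact hf_bdd u (hJ hu.2) _ _
        · rw [← hIreal]
          exact mul_le_mul_of_nonneg_left
            (measureReal_mono Set.inter_subset_left (hIfin i).ne) hc₂.le
      calc _ ≤ (hi i - lo i)⁻¹ * (c₂ * (hi i - lo i)) := by gcongr
        _ = c₂ * 1 := by field_simp
    · rw [Set.not_nonempty_iff_eq_empty.1 h]
      simp
end
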